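/- For every n ∈ ℕ, every invariant length function ℓ on the symmetric group S_n satisfies ℓ(σ^k) ≤ 3 ℓ(σ) for all σ ∈ S_n and all k ∈ ℤ. -/

import Mathlib

open scoped ENNReal Pointwise

/-- An invariant length function on a group `H`, with values in `[0,∞]`. -/
structure IsInvLength {H : Type*} [Group H] (ℓ : H → ℝ≥0∞) : Prop where
  eq_zero_iff : ∀ g : H, ℓ g = 0 ↔ g = 1
  inv_eq : ∀ g : H, ℓ g⁻¹ = ℓ g
  mul_le : ∀ g h : H, ℓ (g * h) ≤ ℓ g + ℓ h
  conj_eq : ∀ g h : H, ℓ (h * g * h⁻¹) = ℓ g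

namespace Equiv.Perm

variable {α : Type*}

/-- If every point is related to its image under `f`, then so are any two points on the same
cycle of `f`. -/
theorem SameCycle.rel_of_forall_rel_apply {f : Perm α} {r : α → α → Prop} (hr : Equivalence r)
    (h : ∀ a, r a (f a)) {a b : α} (hab : f.SameCycle a b) : r a b := by
  obtain ⟨i, rfl⟩ := hab
  induction i with
  | zero => exact hr.refl a
  | succ i ih =>
    rw [add_comm, zpow_add, zpow_one, mul_apply]
    exact hr.trans ih (h _)
  | pred i ih =>
    have h' := h ((f ^ (-(i : ℤ) - 1)) a)
    rw [← mul_apply, ← zpow_one_add, add_sub_cancel] at h'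
    exact hr.trans ih (hr.symm h')

variable [DecidableEq α]

/-- Multiplying by a transposition of points on different cycles puts them on the same cycle. -/
theorem sameCycle_mul_swap_self [Finite α] {f : Perm α} {x y : α} (hxy : ¬ f.SameCycle x y) :
    (f * swap x y).SameCycle x y := by
  have key : ∀ i : ℕ, (f * swap x y).SameCycle x ((f ^ (i + 1)) y) := by
    intro i
    induction i with
    | zero => exact ⟨1, by simp⟩
    | succ i ih =>
      by_cases hy : (f ^ (i + 1)) y = y
      · exact ⟨1, by rw [pow_succ', mul_apply, hy]; simp⟩
      · have hx : (f ^ (i + 1)) y ≠ x := fun h ↦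
          hxy (SameCycle.symm ⟨(i + 1 : ℕ), by rw [zpow_natCast, h]⟩)
        refine ih.trans ⟨1, ?_⟩
        rw [zpow_one, mul_apply, swap_apply_of_ne_of_ne hx hy, pow_succ' f (i + 1), mul_apply]
  have h := key (orderOf f - 1)
  rwa [Nat.sub_add_cancel (orderOf_pos f), pow_orderOf_eq_one, one_apply] at h

/-- Multiplying by a transposition of points on different cycles only merges cycles. -/
theorem SameCycle.mul_swap [Finite α] {f : Perm α} {x y a b : α} (hxy : ¬ f.SameCycle x y)
    (hab : f.SameCycle a b) : (f * swap x y).SameCycle a b := by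
  have h := sameCycle_mul_swap_self hxy
  refine hab.rel_of_forall_rel_apply (SameCycle.equivalence _) fun a ↦ ?_
  by_cases hax : a = x
  · subst hax
    exact h.trans ⟨1, by simp⟩
  by_cases hay : a = y
  · subst hay
    exact h.symm.trans ⟨1, by simp⟩
  · exact ⟨1, by simp [swap_apply_of_ne_of_ne hax hay]⟩

/-- An equivalence relation that contains the cycles of `f` and relates `x` to `y` contains the
cycles of `f * swap x y`. -/
theorem SameCycle.rel_of_mul_swap {f : Perm α} {x y a b : α} {r : α → α → Prop}
    (hr : Equivalence r) (hf : ∀ a b, f.SameCycle a b → r a b) (hxy : r x y)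
    (hab : (f * swap x y).SameCycle a b) : r a b := by
  have hf' : ∀ a, r a (f a) := fun a ↦ hf _ _ ⟨1, by simp⟩
  refine hab.rel_of_forall_rel_apply hr fun a ↦ ?_
  by_cases hax : a = x
  · subst hax
    simpa using hr.trans hxy (hf' y)
  by_cases hay : a = y
  · subst hay
    simpa using hr.trans (hr.symm hxy) (hf' x)
  · simpa [swap_apply_of_ne_of_ne hax hay] using hf' a

/-- Two permutations with the same cycles (as sets), contained in the classes of an equivalence
relation `r`, can be multiplied on the right by a common permutation so that the cycles of both
products are exactly the classes of `r`. -/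
theorem exists_mul_sameCycle_iff [Finite α] {r : α → α → Prop} (hr : Equivalence r)
    (u v : Perm α) (huv : ∀ a b, u.SameCycle a b ↔ v.SameCycle a b)
    (hu : ∀ a b, u.SameCycle a b → r a b) :
    ∃ t : Perm α, (∀ a b, (u * t).SameCycle a b ↔ r a b) ∧
      ∀ a b, (v * t).SameCycle a b ↔ r a b := by
  induction hN : {p : α × α | ¬ u.SameCycle p.1 p.2}.ncard using Nat.strong_induction_on
    generalizing u v with
  | _ N ih =>
    by_cases h : ∀ a b, r a b → u.SameCycle a b
    · refine ⟨1, fun a b ↦ ?_, fun a b ↦ ?_⟩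
      · rw [mul_one]
        exact ⟨hu a b, h a b⟩
      · rw [mul_one, ← huv]
        exact ⟨hu a b, h a b⟩
    · push Not at h
      obtain ⟨x, y, hxy, hux⟩ := h
      have hvx : ¬ v.SameCycle x y := by rwa [← huv]
      have hlt : {p : α × α | ¬ (u * swap x y).SameCycle p.1 p.2}.ncard < N := by
        rw [← hN]
        refine Set.ncard_lt_ncard ⟨fun p hp hp' ↦ hp (hp'.mul_swap hux), fun hsub ↦ ?_⟩
          (Set.toFinite _)
        exact hsub (a := (x, y)) hux (sameCycle_mul_swap_self hux)
      obtain ⟨t, h1, h2⟩ := ih _ hlt (u * swap x y) (v * swap x y)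
        (fun a b ↦
          ⟨fun hab ↦ hab.rel_of_mul_swap (SameCycle.equivalence _)
            (fun a b h ↦ ((huv a b).1 h).mul_swap hvx) (sameCycle_mul_swap_self hvx),
          fun hab ↦ hab.rel_of_mul_swap (SameCycle.equivalence _)
            (fun a b h ↦ ((huv a b).2 h).mul_swap hux) (sameCycle_mul_swap_self hux)⟩)
        (fun a b hab ↦ hab.rel_of_mul_swap hr hu hxy) rfl
      exact ⟨swap x y * t, by simpa only [mul_assoc] using h1,
        by simpa only [mul_assoc] using h2⟩

variable [Fintype α]

theorem cycleType_eq_map_card_image_support (f : Perm α) :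
    f.cycleType = (f.cycleFactorsFinset.image support).val.map Finset.card := by
  have hinj : Set.InjOn support (f.cycleFactorsFinset : Set (Perm α)) := by
    intro c hc d hd hcd
    obtain ⟨x, hx⟩ := (mem_cycleFactorsFinset_iff.1 hc).1.nonempty_support
    rw [cycle_is_cycleOf hx hc, cycle_is_cycleOf (hcd ▸ hx) hd]
  rw [Finset.image_val_of_injOn hinj, Multiset.map_map, cycleType_def]

theorem mem_image_support_cycleFactorsFinset {f : Perm α} {s : Finset α} :
    s ∈ f.cycleFactorsFinset.image support ↔
      ∃ x y, x ≠ y ∧ f.SameCycle x y ∧ ∀ z, z ∈ s ↔ f.SameCycle x z := by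
  rw [Finset.mem_image]
  constructor
  · rintro ⟨c, hc, rfl⟩
    obtain ⟨x, hx⟩ := (mem_cycleFactorsFinset_iff.1 hc).1.nonempty_support
    have hfx := mem_support.1 (mem_cycleFactorsFinset_support_le hc hx)
    refine ⟨x, f x, hfx.symm, ⟨1, by simp⟩, fun z ↦ ?_⟩
    rw [cycle_is_cycleOf hx hc, mem_support_cycleOf_iff' hfx]
  · rintro ⟨x, y, hxy, hf, hs⟩
    have hfx : f x ≠ x := fun h ↦ hxy (hf.eq_of_left h)
    refine ⟨f.cycleOf x, cycleOf_mem_cycleFactorsFinset_iff.2 (mem_support.2 hfx), ?_⟩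
    ext z
    rw [mem_support_cycleOf_iff' hfx, hs]

/-- Permutations with the same cycles (as sets) are conjugate. -/
theorem isConj_of_sameCycle_iff {f g : Perm α}
    (h : ∀ a b, f.SameCycle a b ↔ g.SameCycle a b) : IsConj f g := by
  refine isConj_of_cycleType_eq ?_
  have him : f.cycleFactorsFinset.image support = g.cycleFactorsFinset.image support := by
    ext s
    simp only [mem_image_support_cycleFactorsFinset, h]
  rw [cycleType_eq_map_card_image_support, cycleType_eq_map_card_image_support, him]

/-- An even power of a permutation is a product of a conjugate and an inverse of a conjugate. -/
theorem exists_isConj_zpow_add_self_eq (σ : Perm α) (j : ℤ) :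
    ∃ u v : Perm α, IsConj σ u ∧ IsConj σ v ∧ σ ^ (j + j) = u * v⁻¹ := by
  obtain ⟨t, hu, hv⟩ := exists_mul_sameCycle_iff (SameCycle.equivalence σ) (σ ^ j) (σ ^ j)⁻¹
    (fun a b ↦ sameCycle_inv.symm) (fun a b ↦ SameCycle.of_zpow)
  refine ⟨_, _, (isConj_of_sameCycle_iff hu).symm, (isConj_of_sameCycle_iff hv).symm, ?_⟩
  rw [zpow_add]
  group

end Equiv.Perm

theorem IsInvLength.eq_of_isConj {H : Type*} [Group H] {ℓ : H → ℝ≥0∞} (hℓ : IsInvLength ℓ)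
    {g h : H} (hgh : IsConj g h) : ℓ h = ℓ g := by
  obtain ⟨c, rfl⟩ := isConj_iff.1 hgh
  exact hℓ.conj_eq g c

theorem IsInvLength.perm_zpow_add_self_le {α : Type*} [Fintype α] [DecidableEq α]
    {ℓ : Equiv.Perm α → ℝ≥0∞} (hℓ : IsInvLength ℓ) (σ : Equiv.Perm α) (j : ℤ) :
    ℓ (σ ^ (j + j)) ≤ 2 * ℓ σ := by
  obtain ⟨u, v, hu, hv, h⟩ := σ.exists_isConj_zpow_add_self_eq j
  calc ℓ (σ ^ (j + j)) ≤ ℓ u + ℓ v⁻¹ := h ▸ hℓ.mul_le u v⁻¹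
    _ = 2 * ℓ σ := by rw [hℓ.inv_eq, hℓ.eq_of_isConj hu, hℓ.eq_of_isConj hv, two_mul]

theorem stmt18 (n : ℕ) (ℓ : Equiv.Perm (Fin n) → ℝ≥0∞) (hℓ : IsInvLength ℓ) :
    ∀ (σ : Equiv.Perm (Fin n)) (k : ℤ), ℓ (σ ^ k) ≤ 3 * ℓ σ := by
  intro σ k
  rcases Int.even_or_odd' k with ⟨j, rfl | rfl⟩
  · rw [two_mul]
    refine (hℓ.perm_zpow_add_self_le σ j).trans ?_
    gcongr
    norm_num
  · calc ℓ (σ ^ (2 * j + 1)) ≤ ℓ (σ ^ (j + j)) + ℓ σ := by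
          rw [zpow_add_one, two_mul]
          exact hℓ.mul_le _ _
      _ ≤ 2 * ℓ σ + ℓ σ := by
          gcongr
          exact hℓ.perm_zpow_add_self_le σ j
      _ = 3 * ℓ σ := by ring
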